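/- Let d ≥ 0 and suppose the delayed composite reward stream has spillover bound d. Let 1 ≤ a_1 ≤ b_1 ≤ a_2 ≤ b_2 ≤ ... ≤ a_E ≤ b_E be integers defining E pairwise disjoint intervals [a_j, b_j). Then the aggregate observed reward over the union of these intervals differs from the aggregate generated reward over the same union by at most d·E: | ∑_{j=1}^{E} ( ∑_{T=a_j}^{b_j−1} x_T − ∑_{t=a_j}^{b_j−1} ∑_{τ=0}^{∞} r_t(τ) ) | ≤ d·E. -/

import Mathlib

/-- The total reward generated at the times `1 ≤ t < n` and realized at time `n` or later. -/
noncomputable def pendingReward (r : ℕ → ℕ → ℝ) (n : ℕ) : ℝ :=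
  ∑ t ∈ Finset.Ico 1 n, ∑' τ : ℕ, r t (n - t + τ)

lemma pendingReward_nonneg {r : ℕ → ℕ → ℝ} (hr : ∀ t τ, 1 ≤ t → 0 ≤ r t τ) (n : ℕ) :
    0 ≤ pendingReward r n :=
  Finset.sum_nonneg fun t ht => tsum_nonneg fun _ => hr t _ (Finset.mem_Ico.1 ht).1

lemma pendingReward_le_tsum {r : ℕ → ℕ → ℝ} {c : ℕ → ℝ} (hc : ∀ k, 0 ≤ c k)
    (hcs : Summable c) (h_tail : ∀ t k, 1 ≤ t → ∑' τ : ℕ, r t (k + τ) ≤ c k) (n : ℕ) :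
    pendingReward r n ≤ ∑' k, c k :=
  calc pendingReward r n ≤ ∑ t ∈ Finset.Ico 1 n, c (n - t) :=
        Finset.sum_le_sum fun t ht => h_tail t _ (Finset.mem_Ico.1 ht).1
    _ = ∑ k ∈ Finset.Ico (n + 1 - n) (n + 1 - 1), c k :=
        Finset.sum_Ico_reflect c 1 (Nat.le_succ n)
    _ ≤ ∑' k, c k := hcs.sum_le_tsum _ fun k _ => hc k

/-- Conservation of reward: the observed minus the generated reward at time `n` is the decrease
of the pending reward. -/
lemma sum_sub_tsum_eq_pendingReward_sub {r : ℕ → ℕ → ℝ} (hr : ∀ t, 1 ≤ t → Summable (r t))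
    {n : ℕ} (hn : 1 ≤ n) :
    ∑ t ∈ Finset.Icc 1 n, r t (n - t) - ∑' τ, r n τ =
      pendingReward r n - pendingReward r (n + 1) := by
  have hsplit : ∀ t ∈ Finset.Ico 1 (n + 1), ∑' τ : ℕ, r t (n - t + τ) =
      r t (n - t) + ∑' τ : ℕ, r t (n + 1 - t + τ) := by
    intro t ht
    obtain ⟨h1, h2⟩ := Finset.mem_Ico.1 ht
    have hs : Summable fun τ => r t (n - t + τ) :=
      (hr t h1).comp_injective (add_right_injective (n - t))
    rw [hs.tsum_eq_zero_add, add_zero]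
    congr 1
    refine tsum_congr fun τ => ?_
    congr 1
    omega
  have hsum := Finset.sum_congr rfl hsplit
  rw [Finset.sum_add_distrib, Finset.sum_Ico_succ_top hn] at hsum
  have hIcc : Finset.Icc 1 n = Finset.Ico 1 (n + 1) := by
    ext t
    simp only [Finset.mem_Icc, Finset.mem_Ico]
    omega
  simp only [Nat.sub_self, zero_add] at hsum
  rw [hIcc]
  unfold pendingReward
  linarith

/-- **Observed versus generated reward over disjoint epochs.**
For each time `t ≥ 1`, `r t : ℕ → ℝ` is the nonnegative summable sequence of reward
components generated at time `t` (component `r t τ` is realized at time `t + τ`), and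
the observed reward at time `T` is `x T = ∑_{t=1}^{T} r t (T - t)`.  Suppose the stream
has spillover bound `d ≥ 0` (witnessed by a nonnegative summable `c` with
`∑' k, c k ≤ d` and `∑_{τ=k}^∞ r t τ ≤ c k` for all `t ≥ 1`, `k`).  Given integers
`1 ≤ a 0 ≤ b 0 ≤ a 1 ≤ b 1 ≤ ⋯ ≤ a (E-1) ≤ b (E-1)` defining `E` pairwise disjoint
intervals `[a j, b j)`, the aggregate observed reward over the union of these intervals
differs from the aggregate generated reward over the same union by at most `d * E`. -/
theorem observed_minus_generated_epochs_bounded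
    (r : ℕ → ℕ → ℝ) (d : ℝ) (hd : 0 ≤ d)
    (hr_nonneg : ∀ t τ, 1 ≤ t → 0 ≤ r t τ)
    (hr_summable : ∀ t, 1 ≤ t → Summable (r t))
    (c : ℕ → ℝ) (hc_nonneg : ∀ k, 0 ≤ c k) (hc_summable : Summable c)
    (hc_sum : ∑' k, c k ≤ d)
    (h_tail : ∀ t k, 1 ≤ t → (∑' τ : ℕ, r t (k + τ)) ≤ c k)
    (x : ℕ → ℝ) (hx : ∀ T, x T = ∑ t ∈ Finset.Icc 1 T, r t (T - t))
    (E : ℕ) (hE : 1 ≤ E) (a b : ℕ → ℕ)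
    (ha1 : 1 ≤ a 0)
    (hab : ∀ j, j < E → a j ≤ b j)
    (hba : ∀ j, j + 1 < E → b j ≤ a (j + 1)) :
    |∑ j ∈ Finset.range E,
        ((∑ T ∈ Finset.Ico (a j) (b j), x T)
          - ∑ t ∈ Finset.Ico (a j) (b j), ∑' τ : ℕ, r t τ)| ≤ d * E := by
  have ha : ∀ j, j < E → 1 ≤ a j := by
    intro j
    induction j with
    | zero => exact fun _ => ha1
    | succ j ih =>
      intro hj
      have := ih (by omega)
      have := hab j (by omega)
      have := hba j hj
      omega
  have hepoch : ∀ j ∈ Finset.range E, |(∑ T ∈ Finset.Ico (a j) (b j), x T)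
      - ∑ t ∈ Finset.Ico (a j) (b j), ∑' τ : ℕ, r t τ| ≤ d := by
    intro j hj
    have hjE := Finset.mem_range.1 hj
    have htele : (∑ T ∈ Finset.Ico (a j) (b j), x T)
        - ∑ t ∈ Finset.Ico (a j) (b j), ∑' τ : ℕ, r t τ
        = pendingReward r (a j) - pendingReward r (b j) := by
      rw [← Finset.sum_sub_distrib, ← neg_sub (pendingReward r (b j)),
        ← Finset.sum_Ico_sub (pendingReward r) (hab j hjE), ← Finset.sum_neg_distrib]
      refine Finset.sum_congr rfl fun T hT => ?_
      rw [hx, neg_sub]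
      exact sum_sub_tsum_eq_pendingReward_sub hr_summable
        ((ha j hjE).trans (Finset.mem_Ico.1 hT).1)
    have hbound n : pendingReward r n ≤ d :=
      (pendingReward_le_tsum hc_nonneg hc_summable h_tail n).trans hc_sum
    rw [htele]
    exact abs_sub_le_of_nonneg_of_le (pendingReward_nonneg hr_nonneg _) (hbound _)
      (pendingReward_nonneg hr_nonneg _) (hbound _)
  calc _ ≤ _ := Finset.abs_sum_le_sum_abs _ _
    _ ≤ ∑ _j ∈ Finset.range E, d := Finset.sum_le_sum hepoch
    _ = d * E := by rw [Finset.sum_const, Finset.card_range, nsmul_eq_mul, mul_comm]
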